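/- arXiv:1502.02590 — 2 statements merged into one kernel-verified Lean document; each statement's English description precedes it below -/
import Mathlib

section
/- Let f(x) = wᵀx + b be a linear classifier on ℝ^d with w ≠ 0, let x ∈ ℝ^d, and let ε ∈ (0, 1/12). Then Δ_unif,ε(x;f) ≤ C̃₂(ε,d) · Δ_adv(x;f), where C̃₂(ε,d) = (1 − (12ε)^{1/d})^{−1/2}. -/
open MeasureTheory Metric
open scoped RealInnerProductSpace ENNReal

/-- The minimal norm of an adversarial perturbation flipping the sign of `f` at `x`:
`Δ_adv(x; f) = inf {‖r‖₂ : f(x)·f(x+r) ≤ 0}`. -/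
noncomputable def deltaAdv {d : ℕ} (f : EuclideanSpace ℝ (Fin d) → ℝ)
    (x : EuclideanSpace ℝ (Fin d)) : ℝ :=
  sInf {t : ℝ | ∃ r : EuclideanSpace ℝ (Fin d), ‖r‖ = t ∧ f x * f (x + r) ≤ 0}

/-- The uniform (rotation-invariant) probability measure on the sphere of radius `η`
centered at `0` in `ℝ^d`, viewed as a measure on the ambient space. -/
noncomputable def unifSphere (d : ℕ) (η : ℝ) : Measure (EuclideanSpace ℝ (Fin d)) :=
  ((volume : Measure (EuclideanSpace ℝ (Fin d))).toSphere Set.univ)⁻¹ •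
    Measure.map
      (fun z : Metric.sphere (0 : EuclideanSpace ℝ (Fin d)) 1 =>
        η • (z : EuclideanSpace ℝ (Fin d)))
      (volume : Measure (EuclideanSpace ℝ (Fin d))).toSphere

/-- Robustness to random uniform noise at `x`:
`Δ_unif,ε(x; f) = sup {η ≥ 0 : P_{n ~ η𝕊}(f(x) f(x+n) ≤ 0) ≤ ε}`. -/
noncomputable def deltaUnif {d : ℕ} (f : EuclideanSpace ℝ (Fin d) → ℝ) (ε : ℝ)
    (x : EuclideanSpace ℝ (Fin d)) : ℝ :=
  sSup {η : ℝ | 0 ≤ η ∧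
    unifSphere d η {n | f x * f (x + n) ≤ 0} ≤ ENNReal.ofReal ε}

section InnerProductSpace

open scoped Pointwise

variable {E : Type*} [NormedAddCommGroup E] [InnerProductSpace ℝ E] [FiniteDimensional ℝ E]
  [MeasurableSpace E] [BorelSpace E]

/-- The second moment of the unit ball is the same in all directions. -/
lemma setLIntegral_ball_inner_sq_eq {u v : E} (huv : ‖u‖ = ‖v‖) :
    ∫⁻ y in ball (0 : E) 1, ENNReal.ofReal (⟪u, y⟫ ^ 2) =
      ∫⁻ y in ball (0 : E) 1, ENNReal.ofReal (⟪v, y⟫ ^ 2) := by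
  set φ : E ≃ₗᵢ[ℝ] E := (ℝ ∙ (u - v))ᗮ.reflection
  have hφ : φ u = v := Submodule.reflection_sub huv
  have h := φ.measurePreserving.setLIntegral_comp_preimage (s := ball (0 : E) 1)
    measurableSet_ball (f := fun y => ENNReal.ofReal (⟪v, y⟫ ^ 2)) (by fun_prop)
  have hball : φ ⁻¹' ball 0 1 = ball 0 1 := by ext; simp
  rw [← h, hball]
  simp only [← hφ, φ.inner_map_map]

lemma finrank_mul_setLIntegral_ball_inner_sq_le {u : E} (hu : ‖u‖ = 1) :
    Module.finrank ℝ E * ∫⁻ y in ball (0 : E) 1, ENNReal.ofReal (⟪u, y⟫ ^ 2) ≤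
      volume (ball (0 : E) 1) := by
  let b := stdOrthonormalBasis ℝ E
  calc
    _ = ∑ i, ∫⁻ y in ball (0 : E) 1, ENNReal.ofReal (⟪b i, y⟫ ^ 2) := by
      simp [fun i => setLIntegral_ball_inner_sq_eq ((b.norm_eq_one i).trans hu.symm)]
    _ = ∫⁻ y in ball (0 : E) 1, ENNReal.ofReal (‖y‖ ^ 2) := by
      rw [← lintegral_finsetSum _ (by fun_prop)]
      refine lintegral_congr fun y => ?_
      rw [← ENNReal.ofReal_sum_of_nonneg (fun _ _ => sq_nonneg _), b.sum_sq_inner_right]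
    _ ≤ ∫⁻ _ in ball (0 : E) 1, 1 := by
      refine setLIntegral_mono measurable_const fun y hy => ?_
      rw [mem_ball_zero_iff] at hy
      exact ENNReal.ofReal_le_one.2 (pow_le_one₀ (norm_nonneg y) hy.le)
    _ = _ := by simp

/-- At least a quarter of the unit ball lies in the slab `0 ≤ ⟪u, y⟫ ≤ √(2 / dim E)`. -/
lemma volume_ball_le_four_mul_slab {u : E} (hu : ‖u‖ = 1) :
    volume (ball (0 : E) 1) ≤ 4 * volume {y : E | y ∈ ball (0 : E) 1 ∧ 0 ≤ ⟪u, y⟫ ∧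
      Module.finrank ℝ E * ⟪u, y⟫ ^ 2 ≤ 2} := by
  set H := {y : E | y ∈ ball (0 : E) 1 ∧ 0 ≤ ⟪u, y⟫ ∧ Module.finrank ℝ E * ⟪u, y⟫ ^ 2 ≤ 2}
  set T := {y : E | 2 ≤ ENNReal.ofReal (Module.finrank ℝ E * ⟪u, y⟫ ^ 2)}
  have hT : 2 * volume (T ∩ ball (0 : E) 1) ≤ volume (ball (0 : E) 1) := by
    rw [← Measure.restrict_apply' measurableSet_ball]
    refine (mul_meas_ge_le_lintegral (by fun_prop) 2).trans ?_
    refine le_trans (le_of_eq ?_) (finrank_mul_setLIntegral_ball_inner_sq_le hu)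
    rw [← lintegral_const_mul _ (by fun_prop)]
    refine lintegral_congr fun y => ?_
    rw [ENNReal.ofReal_mul (by positivity), ENNReal.ofReal_natCast]
  have hsub : ball (0 : E) 1 ⊆ (T ∩ ball (0 : E) 1) ∪ (H ∪ -H) := by
    intro y hy
    by_cases h2 : Module.finrank ℝ E * ⟪u, y⟫ ^ 2 ≤ 2
    · refine Or.inr ?_
      rcases le_total 0 ⟪u, y⟫ with h | h
      · exact Or.inl ⟨hy, h, h2⟩
      · refine Or.inr ⟨by simpa using hy, ?_, ?_⟩
        · simpa [inner_neg_right] using h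
        · simpa [inner_neg_right] using h2
    · refine Or.inl ⟨?_, hy⟩
      change (2 : ℝ≥0∞) ≤ _
      rw [← ENNReal.ofReal_ofNat]
      exact ENNReal.ofReal_le_ofReal (not_le.1 h2).le
  have hle : volume (ball (0 : E) 1) ≤
      volume (T ∩ ball (0 : E) 1) + 2 * volume H := by
    refine (measure_mono hsub).trans ((measure_union_le _ _).trans ?_)
    gcongr
    refine (measure_union_le _ _).trans (le_of_eq ?_)
    rw [Measure.measure_neg, two_mul]
  have hB : volume (ball (0 : E) 1) ≠ ∞ := measure_ball_lt_top.ne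
  have h2 : volume (ball (0 : E) 1) + volume (ball (0 : E) 1) ≤
      volume (ball (0 : E) 1) + 4 * volume H := by
    calc
      _ = 2 * volume (ball (0 : E) 1) := (two_mul _).symm
      _ ≤ 2 * (volume (T ∩ ball (0 : E) 1) + 2 * volume H) := by gcongr
      _ = 2 * volume (T ∩ ball (0 : E) 1) + 4 * volume H := by
        rw [mul_add, ← mul_assoc]; norm_num
      _ ≤ _ := by gcongr
  exact (ENNReal.add_le_add_iff_left hB).1 h2

/-- The pointwise estimate behind the lower bound on the measure of a cap. -/
lemma pow_div_three_le_div_sqrt_pow {n : ℕ} (hn : 0 < n) {t : ℝ} (ht0 : 0 < t) (ht1 : t < 1) :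
    (1 - t ^ 2) ^ n / 3 ≤
      (√(1 - t ^ 2) / √(1 + 2 * t * √(1 - t ^ 2) * √(2 / n))) ^ n := by
  have hn' : (0 : ℝ) < n := by exact_mod_cast hn
  have hs2 : 0 < 1 - t ^ 2 := by nlinarith
  set s := √(1 - t ^ 2)
  have hs : 0 < s := Real.sqrt_pos.2 hs2
  have hss : s ^ 2 = 1 - t ^ 2 := Real.sq_sqrt hs2.le
  have hs1 : s ≤ 1 := by nlinarith
  set q := √(2 / (n : ℝ))
  have hq : 0 ≤ q := Real.sqrt_nonneg _
  have hqq : n * q ^ 2 = 2 := by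
    rw [Real.sq_sqrt (by positivity)]; field_simp
  have hR0 : 0 < 1 + 2 * t * s * q := by positivity
  set R := √(1 + 2 * t * s * q)
  have hR : 0 < R := Real.sqrt_pos.2 hR0
  have hRR : R ^ 2 = 1 + 2 * t * s * q := Real.sq_sqrt hR0.le
  have hexp : (s * R) ^ 2 ≤ Real.exp (2 * t * q - t ^ 2) := by
    rw [mul_pow, hss, hRR, show 2 * t * q - t ^ 2 = -t ^ 2 + 2 * t * q by ring, Real.exp_add]
    have h1 := Real.add_one_le_exp (-t ^ 2)
    have h2 := Real.add_one_le_exp (2 * t * q)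
    have h3 : 2 * t * s * q ≤ 2 * t * q := by
      have : 0 ≤ 2 * t * q := by positivity
      nlinarith
    gcongr <;> linarith
  have hsR : (s * R) ^ n ≤ 3 := by
    refine (sq_le_sq₀ (by positivity) (by norm_num)).1 ?_
    calc
      ((s * R) ^ n) ^ 2 = ((s * R) ^ 2) ^ n := by ring
      _ ≤ Real.exp (2 * t * q - t ^ 2) ^ n := by gcongr
      _ = Real.exp (n * (2 * t * q - t ^ 2)) := (Real.exp_nat_mul _ _).symm
      _ ≤ Real.exp (2 * 1) := by
        refine Real.exp_le_exp.2 ?_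
        nlinarith [mul_nonneg hn'.le (sq_nonneg (t - q))]
      _ = Real.exp 1 ^ 2 := by rw [← Real.exp_nat_mul]; norm_num
      _ ≤ 3 ^ 2 := by
        have := Real.exp_one_lt_d9
        gcongr
        linarith
  rw [div_pow, div_le_div_iff₀ (by norm_num) (by positivity), ← hss]
  calc
    (s ^ 2) ^ n * R ^ n = s ^ n * (s * R) ^ n := by ring
    _ ≤ s ^ n * 3 := by gcongr

/-- A lower bound for the measure of a spherical cap. -/
lemma ofReal_mul_toSphere_univ_le_toSphere_cap {u : E} (hu : ‖u‖ = 1) {t : ℝ}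
    (ht0 : 0 < t) (ht1 : t < 1) :
    ENNReal.ofReal ((1 - t ^ 2) ^ Module.finrank ℝ E / 12) *
        (volume : Measure E).toSphere Set.univ ≤
      (volume : Measure E).toSphere {z : sphere (0 : E) 1 | t ≤ ⟪u, (z : E)⟫} := by
  have hu0 : u ≠ 0 := by rintro rfl; simp at hu
  have : Nontrivial E := ⟨u, 0, hu0⟩
  have hn : 0 < Module.finrank ℝ E := Module.finrank_pos
  have hn' : (0 : ℝ) < Module.finrank ℝ E := by exact_mod_cast hn
  have hmeas : MeasurableSet {z : sphere (0 : E) 1 | t ≤ ⟪u, (z : E)⟫} :=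
    (isClosed_le continuous_const (by fun_prop)).measurableSet
  rw [Measure.toSphere_apply' _ hmeas, Measure.toSphere_apply_univ, mul_left_comm]
  gcongr
  have hest := pow_div_three_le_div_sqrt_pow hn ht0 ht1
  have hs2 : 0 < 1 - t ^ 2 := by nlinarith
  set s := √(1 - t ^ 2)
  have hs : 0 < s := Real.sqrt_pos.2 hs2
  have hss : s ^ 2 = 1 - t ^ 2 := Real.sq_sqrt hs2.le
  set q := √(2 / (Module.finrank ℝ E : ℝ))
  have hR0 : 0 < 1 + 2 * t * s * q := by positivity
  set R := √(1 + 2 * t * s * q)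
  have hR : 0 < R := Real.sqrt_pos.2 hR0
  have hRR : R ^ 2 = 1 + 2 * t * s * q := Real.sq_sqrt hR0.le
  set H := {y : E | y ∈ ball (0 : E) 1 ∧ 0 ≤ ⟪u, y⟫ ∧ Module.finrank ℝ E * ⟪u, y⟫ ^ 2 ≤ 2}
  set K := Set.Ioo (0 : ℝ) 1 • ((↑) '' {z : sphere (0 : E) 1 | t ≤ ⟪u, (z : E)⟫} : Set E)
  have hsub : (s / R) • H ⊆ (fun y => (R⁻¹ * t) • u + y) ⁻¹' K := by
    rintro _ ⟨y, ⟨hy, hp, hp2⟩, rfl⟩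
    rw [mem_ball_zero_iff] at hy
    set p := ⟪u, y⟫
    have hpq : p ≤ q := by
      refine Real.le_sqrt_of_sq_le ?_
      rw [le_div_iff₀ hn']; linarith
    set v := t • u + s • y
    have hv : (R⁻¹ * t) • u + (s / R) • y = R⁻¹ • v := by
      simp only [v, smul_add, smul_smul]
      congr 2
      ring
    have huv : ⟪u, v⟫ = t + s * p := by
      simp [v, inner_add_right, inner_smul_right, hu, p]
    have hvv : ‖v‖ ^ 2 = t ^ 2 + 2 * t * s * p + s ^ 2 * ‖y‖ ^ 2 := by
      simp only [v]
      rw [norm_add_sq_real, norm_smul, norm_smul, mul_pow, mul_pow, hu, inner_smul_left,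
        inner_smul_right]
      simp [p]
      ring
    have hy2 : ‖y‖ ^ 2 < 1 := by nlinarith [norm_nonneg y]
    have hsp : 0 ≤ s * p := by positivity
    have hv0 : 0 < ‖v‖ := by
      refine norm_pos_iff.2 fun h => ?_
      rw [h, inner_zero_right] at huv
      linarith
    have hvR : ‖v‖ < R := by
      refine lt_of_pow_lt_pow_left₀ 2 hR.le ?_
      rw [hvv, hRR]
      have h1 : 2 * t * s * p ≤ 2 * t * s * q := by gcongr
      nlinarith [sq_nonneg s]
    have htv : t * ‖v‖ ≤ ⟪u, v⟫ := by
      rw [huv]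
      refine (sq_le_sq₀ (by positivity) (by positivity)).1 ?_
      rw [mul_pow, hvv]
      have h1 : t ^ 2 * (s ^ 2 * ‖y‖ ^ 2) ≤ t ^ 2 * s ^ 2 := by
        have : 0 ≤ t ^ 2 * s ^ 2 := by positivity
        nlinarith
      have h2 : t ^ 2 * (2 * t * s * p) ≤ 1 * (2 * t * s * p) := by
        gcongr
        nlinarith
      nlinarith [sq_nonneg (s * p)]
    change (R⁻¹ * t) • u + (s / R) • y ∈ K
    rw [hv]
    refine Set.mem_smul.2 ⟨R⁻¹ * ‖v‖, ⟨by positivity, ?_⟩, ‖v‖⁻¹ • v,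
      ⟨⟨‖v‖⁻¹ • v, ?_⟩, ?_, rfl⟩, ?_⟩
    · rw [inv_mul_lt_iff₀ hR]; linarith
    · simp [norm_smul, hv0.ne']
    · change t ≤ ⟪u, ‖v‖⁻¹ • v⟫
      rw [inner_smul_right, ← div_eq_inv_mul, le_div_iff₀ hv0]
      exact htv
    · rw [smul_smul, mul_assoc, mul_inv_cancel₀ hv0.ne', mul_one]
  calc
    _ ≤ ENNReal.ofReal ((1 - t ^ 2) ^ Module.finrank ℝ E / 12) * (4 * volume H) := by
      gcongr; exact volume_ball_le_four_mul_slab hu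
    _ = ENNReal.ofReal ((1 - t ^ 2) ^ Module.finrank ℝ E / 3) * volume H := by
      rw [← mul_assoc, ← ENNReal.ofReal_ofNat 4, ← ENNReal.ofReal_mul (by positivity)]
      congr 2
      ring
    _ ≤ ENNReal.ofReal |(s / R) ^ Module.finrank ℝ E| * volume H := by
      gcongr
      exact hest.trans (le_abs_self _)
    _ = volume ((s / R) • H) := (Measure.addHaar_smul _ _ _).symm
    _ ≤ _ := (measure_mono hsub).trans_eq (measure_preimage_add _ _ _)

end InnerProductSpace

lemma ofReal_le_unifSphere {d : ℕ} (hd : 0 < d) {η c : ℝ} {S : Set (EuclideanSpace ℝ (Fin d))}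
    {A : Set (sphere (0 : EuclideanSpace ℝ (Fin d)) 1)}
    (hA : ∀ z ∈ A, η • (z : EuclideanSpace ℝ (Fin d)) ∈ S)
    (h : ENNReal.ofReal c *
        (volume : Measure (EuclideanSpace ℝ (Fin d))).toSphere Set.univ ≤
      (volume : Measure (EuclideanSpace ℝ (Fin d))).toSphere A) :
    ENNReal.ofReal c ≤ unifSphere d η S := by
  have : Nonempty (Fin d) := ⟨⟨0, hd⟩⟩
  set σ := (volume : Measure (EuclideanSpace ℝ (Fin d))).toSphere
  have h0 : σ Set.univ ≠ 0 :=
    Measure.measure_univ_ne_zero.2 (Measure.toSphere_ne_zero _)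
  rw [unifSphere, Measure.smul_apply, smul_eq_mul, ← ENNReal.div_eq_inv_mul,
    ENNReal.le_div_iff_mul_le (Or.inl h0) (Or.inl (measure_ne_top σ _))]
  refine h.trans ((measure_mono hA).trans (Measure.le_map_apply ?_ S))
  exact (by fun_prop : Continuous fun z : sphere (0 : EuclideanSpace ℝ (Fin d)) 1 =>
    η • (z : EuclideanSpace ℝ (Fin d))).measurable.aemeasurable

lemma abs_div_norm_le_deltaAdv_affine {d : ℕ} {w : EuclideanSpace ℝ (Fin d)} (hw : w ≠ 0) (b : ℝ)
    (x : EuclideanSpace ℝ (Fin d)) :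
    |⟪w, x⟫ + b| / ‖w‖ ≤ deltaAdv (fun y => ⟪w, y⟫ + b) x := by
  have hw' : 0 < ‖w‖ := norm_pos_iff.2 hw
  refine le_csInf ⟨_, -((⟪w, x⟫ + b) / ‖w‖ ^ 2) • w, rfl, ?_⟩ ?_
  · simp only [inner_add_right, inner_smul_right, real_inner_self_eq_norm_sq]
    field_simp
    simp
  · rintro _ ⟨r, rfl, hr⟩
    rw [div_le_iff₀ hw']
    simp only [inner_add_right] at hr
    set a := ⟪w, x⟫ + b with ha
    have h1 : |a| * |a| ≤ |a| * (‖r‖ * ‖w‖) := by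
      have h2 := abs_real_inner_le_norm w r
      have h3 := neg_le_abs (a * ⟪w, r⟫)
      rw [abs_mul] at h3
      have h4 : |a| * |⟪w, r⟫| ≤ |a| * (‖w‖ * ‖r‖) := by gcongr
      have h5 : |a| * |a| = a * a := abs_mul_abs_self a
      have h6 : a * (⟪w, x⟫ + ⟪w, r⟫ + b) = a * a + a * ⟪w, r⟫ := by rw [ha]; ring
      rw [mul_comm ‖r‖]
      linarith
    rcases (abs_nonneg a).eq_or_lt with h0 | h0
    · rw [← h0]; positivity
    · exact le_of_mul_le_mul_left h1 h0

/-- Noise of norm larger than the distance to the decision boundary flips the sign with at least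
the probability of a spherical cap. -/
lemma ofReal_le_unifSphere_affine {d : ℕ} (hd : 0 < d) {w : EuclideanSpace ℝ (Fin d)}
    (hw : w ≠ 0) (b : ℝ) (x : EuclideanSpace ℝ (Fin d)) (ha : ⟪w, x⟫ + b ≠ 0) {η : ℝ}
    (hη : |⟪w, x⟫ + b| / ‖w‖ < η) :
    ENNReal.ofReal ((1 - (|⟪w, x⟫ + b| / ‖w‖ / η) ^ 2) ^ d / 12) ≤
      unifSphere d η {n | (⟪w, x⟫ + b) * (⟪w, x + n⟫ + b) ≤ 0} := by
  have hw' : 0 < ‖w‖ := norm_pos_iff.2 hw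
  set a := ⟪w, x⟫ + b with ha_def
  have ha' : 0 < |a| := abs_pos.2 ha
  have hδ : 0 < |a| / ‖w‖ := by positivity
  have hη0 : 0 < η := hδ.trans hη
  set u := (-(a / (|a| * ‖w‖))) • w
  have hu : ‖u‖ = 1 := by
    simp only [u, norm_smul, norm_neg, norm_div, norm_mul, Real.norm_eq_abs, abs_abs, abs_norm]
    field_simp
  have hcap := ofReal_mul_toSphere_univ_le_toSphere_cap hu (div_pos hδ hη0)
    ((div_lt_one hη0).2 hη)
  rw [finrank_euclideanSpace_fin] at hcap
  refine ofReal_le_unifSphere hd (fun z hz => ?_) hcap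
  change |a| / ‖w‖ / η ≤ ⟪u, (z : EuclideanSpace ℝ (Fin d))⟫ at hz
  change a * (⟪w, x + η • (z : EuclideanSpace ℝ (Fin d))⟫ + b) ≤ 0
  simp only [u, inner_smul_left, inner_add_right, inner_smul_right] at hz ⊢
  set p := ⟪w, (z : EuclideanSpace ℝ (Fin d))⟫
  have h1 : |a| * |a| ≤ -(a * p) * η := by
    have h2 : (starRingEnd ℝ) (-(a / (|a| * ‖w‖))) * p = -(a * p) / (|a| * ‖w‖) := by
      simp; ring
    rw [h2, div_div, div_le_div_iff₀ (by positivity) (by positivity)] at hz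
    refine le_of_mul_le_mul_right ?_ hw'
    linarith
  rw [abs_mul_abs_self] at h1
  have h3 : a * (⟪w, x⟫ + η * p + b) = a * a + a * p * η := by rw [ha_def]; ring
  linarith

/-- **Pointwise upper bound (proof of Theorem 2).** For a linear classifier
`f(x) = wᵀx + b` with `w ≠ 0` and `ε ∈ (0, 1/12)`,
`Δ_unif,ε(x;f) ≤ C̃₂(ε,d) · Δ_adv(x;f)` with `C̃₂(ε,d) = (1 − (12ε)^{1/d})^{-1/2}`. -/
theorem linear_deltaUnif_le_pointwise {d : ℕ} (hd : 0 < d)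
    (w : EuclideanSpace ℝ (Fin d)) (hw : w ≠ 0) (b : ℝ)
    (x : EuclideanSpace ℝ (Fin d)) (ε : ℝ) (hε0 : 0 < ε) (hε : ε < 1 / 12) :
    deltaUnif (fun y => ⟪w, y⟫ + b) ε x ≤
      (1 - (12 * ε) ^ ((d : ℝ)⁻¹)) ^ (-(1 / 2) : ℝ) *
        deltaAdv (fun y => ⟪w, y⟫ + b) x := by
  have hd' : (0 : ℝ) < d := by exact_mod_cast hd
  set κ := (12 * ε) ^ ((d : ℝ)⁻¹)
  have hκ0 : 0 < κ := by positivity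
  have hκ1 : κ < 1 := Real.rpow_lt_one (by positivity) (by linarith) (by positivity)
  have hκd : κ ^ d = 12 * ε := Real.rpow_inv_natCast_pow (by positivity) hd.ne'
  set δ := |⟪w, x⟫ + b| / ‖w‖ with hδ_def
  have hδ0 : 0 ≤ δ := by positivity
  have hsq : 0 < √(1 - κ) := Real.sqrt_pos.2 (by linarith)
  have hC : (1 - κ) ^ (-(1 / 2) : ℝ) = (√(1 - κ))⁻¹ := by
    rw [Real.rpow_neg (by linarith), Real.sqrt_eq_rpow]
  rw [hC]
  refine le_trans ?_ (mul_le_mul_of_nonneg_left (abs_div_norm_le_deltaAdv_affine hw b x)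
    (inv_nonneg.2 hsq.le))
  rw [← hδ_def, ← div_eq_inv_mul]
  refine Real.sSup_le ?_ (by positivity)
  rintro η ⟨hη0, hη⟩
  rw [le_div_iff₀ hsq]
  by_cases ha : ⟪w, x⟫ + b = 0
  · exfalso
    have h1 := (ofReal_le_unifSphere hd (c := 1) (A := Set.univ) (by simp [ha])
      (by simp)).trans hη
    rw [ENNReal.ofReal_le_ofReal_iff hε0.le] at h1
    linarith
  rcases le_or_gt η δ with h | h
  · have h1 : √(1 - κ) ≤ 1 := Real.sqrt_le_one.2 (by linarith)
    nlinarith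
  · have h1 := (ofReal_le_unifSphere_affine hd hw b x ha h).trans hη
    rw [ENNReal.ofReal_le_ofReal_iff hε0.le, ← hδ_def] at h1
    have hη' : 0 < η := hδ0.trans_lt h
    have h2 : 1 - (δ / η) ^ 2 ≤ κ := by
      refine le_of_not_gt fun h3 => ?_
      have h4 := pow_lt_pow_left₀ h3 hκ0.le hd.ne'
      linarith
    have h3 : √(1 - κ) ≤ δ / η := Real.sqrt_le_iff.2 ⟨by positivity, by linarith⟩
    rw [le_div_iff₀ hη'] at h3
    linarith
end

section
/- Let f(x) = wᵀx + b be a linear classifier on ℝ^d with w ≠ 0, let x ∈ ℝ^d with f(x) > 0, and let η > 0. If n is sampled from the uniform (rotation-invariant) probability measure on the sphere of radius η centered at 0 in ℝ^d, then P(f(x + n) ≤ 0) ≤ 2 exp(− Δ_adv(x;f)² d / (2η²)); moreover, if η ≥ Δ_adv(x;f), then P(f(x + n) ≤ 0) ≥ (1/12)(1 − Δ_adv(x;f)²/η²)^d. -/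
open MeasureTheory Metric
open scoped RealInnerProductSpace ENNReal

theorem exists_measurePreserving_inner_prod {n : ℕ} {v : EuclideanSpace ℝ (Fin (n + 1))}
    (hv : ‖v‖ = 1) :
    ∃ φ : EuclideanSpace ℝ (Fin (n + 1)) → ℝ × EuclideanSpace ℝ (Fin n),
      MeasurePreserving φ ∧ ∀ y, (φ y).1 = ⟪v, y⟫ ∧ ‖y‖ ^ 2 = (φ y).1 ^ 2 + ‖(φ y).2‖ ^ 2 := by
  have hv' : Orthonormal ℝ (({0} : Set (Fin (n + 1))).domRestrict fun _ => v) := by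
    rw [orthonormal_iff_ite]
    rintro ⟨i, rfl⟩ ⟨j, rfl⟩
    simp [hv]
  obtain ⟨b, hb⟩ := hv'.exists_orthonormalBasis_extension_of_card_eq (by simp)
  have h1 := b.measurePreserving_repr
  have h2 := PiLp.volume_preserving_ofLp (Fin (n + 1))
  have h3 := volume_preserving_piFinSuccAbove (fun _ : Fin (n + 1) => ℝ) 0
  have h4 := (MeasurePreserving.id (volume : Measure ℝ)).prod (PiLp.volume_preserving_toLp (Fin n))
  refine ⟨_, h4.comp (h3.comp (h2.comp h1)), fun y => ⟨?_, ?_⟩⟩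
  · simp [b.repr_apply_apply, hb 0 rfl]
  · rw [← b.repr.norm_map y, EuclideanSpace.norm_sq_eq, EuclideanSpace.norm_sq_eq,
      Fin.sum_univ_succ]
    simp [Fin.tail]

theorem volume_ball_inter_inner_gt {n : ℕ} {v : EuclideanSpace ℝ (Fin (n + 1))} (hv : ‖v‖ = 1)
    {a : ℝ} (ha : -1 ≤ a) (ha' : a ≤ 1) :
    volume {y : EuclideanSpace ℝ (Fin (n + 1)) | ‖y‖ < 1 ∧ a < ⟪v, y⟫} =
      ENNReal.ofReal (∫ t in a..1, √(1 - t ^ 2) ^ n) *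
        volume (ball (0 : EuclideanSpace ℝ (Fin n)) 1) := by
  obtain ⟨φ, hφ, h⟩ := exists_measurePreserving_inner_prod hv
  set S : Set (ℝ × EuclideanSpace ℝ (Fin n)) := {p | p.1 ^ 2 + ‖p.2‖ ^ 2 < 1 ∧ a < p.1}
  have hS : MeasurableSet S :=
    (measurableSet_lt (f := fun p : ℝ × EuclideanSpace ℝ (Fin n) => p.1 ^ 2 + ‖p.2‖ ^ 2)
      (by fun_prop) measurable_const).inter (measurableSet_lt measurable_const measurable_fst)
  have hpre : {y : EuclideanSpace ℝ (Fin (n + 1)) | ‖y‖ < 1 ∧ a < ⟪v, y⟫} = φ ⁻¹' S := by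
    ext y
    simp only [Set.mem_ofPred_eq, Set.mem_preimage, S]
    rw [← (h y).2, (h y).1, sq_lt_one_iff₀ (norm_nonneg y)]
  have hslice : ∀ t, volume (Prod.mk t ⁻¹' S) =
      (Set.Ioo a 1).indicator (fun t => ENNReal.ofReal (√(1 - t ^ 2) ^ n) *
        volume (ball (0 : EuclideanSpace ℝ (Fin n)) 1)) t := by
    intro t
    by_cases ht : t ∈ Set.Ioo a 1
    · have h0 : 0 < 1 - t ^ 2 := by nlinarith [ht.1, ht.2]
      have : Prod.mk t ⁻¹' S = ball (0 : EuclideanSpace ℝ (Fin n)) √(1 - t ^ 2) := by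
        ext y
        simp only [Set.mem_preimage, S, Set.mem_ofPred_eq, mem_ball_zero_iff, ht.1, and_true]
        rw [Real.lt_sqrt (norm_nonneg y)]
        constructor <;> intro <;> linarith
      rw [this, Set.indicator_of_mem ht, Measure.addHaar_ball_of_pos _ _ (Real.sqrt_pos.2 h0)]
      simp
    · rw [Set.indicator_of_notMem ht]
      have : Prod.mk t ⁻¹' S = ∅ := by
        ext y
        simp only [Set.mem_preimage, S, Set.mem_ofPred_eq, Set.mem_empty_iff_false, iff_false]
        rintro ⟨h1, h2⟩
        exact ht ⟨h2, by nlinarith [sq_nonneg ‖y‖]⟩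
      simp [this]
  have hc : Continuous fun t : ℝ => √(1 - t ^ 2) ^ n := by fun_prop
  rw [hpre, hφ.measure_preimage hS.nullMeasurableSet, Measure.volume_eq_prod,
    Measure.prod_apply hS]
  simp_rw [hslice]
  rw [lintegral_indicator measurableSet_Ioo, lintegral_mul_const _ (by fun_prop),
    intervalIntegral.integral_of_le ha', integral_Ioc_eq_integral_Ioo,
    ofReal_integral_eq_lintegral_ofReal]
  · exact (hc.continuousOn.integrableOn_Icc (a := a) (b := 1)).mono_set Set.Ioo_subset_Icc_self
  · exact Filter.Eventually.of_forall fun t => by positivity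

theorem sqrt_mul_mul_sqrt_pow_le_one (n : ℕ) {t : ℝ} (h0 : 0 ≤ t) (h1 : t ≤ 1) :
    √(n + 1) * (t * √(1 - t ^ 2) ^ n) ≤ 1 := by
  have hs : 0 ≤ 1 - t ^ 2 := by nlinarith
  have hb := one_add_mul_le_pow (a := t ^ 2) (by nlinarith) n
  have hprod : (1 - t ^ 2) ^ n * (1 + t ^ 2) ^ n ≤ 1 := by
    rw [← mul_pow]
    exact pow_le_one₀ (by positivity) (by nlinarith [sq_nonneg (t ^ 2)])
  have hp : 0 ≤ (1 - t ^ 2) ^ n := by positivity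
  have hsq : (√(n + 1) * (t * √(1 - t ^ 2) ^ n)) ^ 2 = (n + 1) * (t ^ 2 * (1 - t ^ 2) ^ n) := by
    rw [mul_pow, mul_pow, Real.sq_sqrt (by positivity), ← pow_mul, mul_comm n 2, pow_mul,
      Real.sq_sqrt hs]
  have hle : ((n : ℝ) + 1) * t ^ 2 ≤ 1 + n * t ^ 2 := by nlinarith
  refine (sq_le_one_iff₀ (by positivity)).1 ?_
  rw [hsq]
  calc ((n : ℝ) + 1) * (t ^ 2 * (1 - t ^ 2) ^ n)
      = (1 - t ^ 2) ^ n * ((n + 1) * t ^ 2) := by ring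
    _ ≤ (1 - t ^ 2) ^ n * (1 + t ^ 2) ^ n := by gcongr; exact hle.trans hb
    _ ≤ 1 := hprod

theorem integral_mul_sqrt_pow (n : ℕ) {a : ℝ} (h0 : 0 ≤ a) (h1 : a ≤ 1) :
    ∫ t in a..1, t * √(1 - t ^ 2) ^ n = √(1 - a ^ 2) ^ (n + 2) / (n + 2) := by
  have hd : ∀ t ∈ Set.Ioo a 1, HasDerivAt (fun t : ℝ => -(√(1 - t ^ 2) ^ (n + 2) / (n + 2)))
      (t * √(1 - t ^ 2) ^ n) t := by
    intro t ht
    have hpos : 0 < 1 - t ^ 2 := by nlinarith [ht.1, ht.2]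
    have h := ((((hasDerivAt_id t).pow 2).const_sub 1).sqrt
      (by simpa using hpos.ne')).pow (n + 2) |>.div_const ((n : ℝ) + 2) |>.neg
    refine h.congr_deriv ?_
    have := (Real.sqrt_pos.2 hpos).ne'
    have hn : (n : ℝ) + 2 ≠ 0 := by positivity
    simp
    field_simp
    ring
  rw [intervalIntegral.integral_eq_sub_of_hasDerivAt_of_le h1 (by fun_prop) hd
    (Continuous.intervalIntegrable (by fun_prop) _ _)]
  simp

theorem sqrt_mul_integral_sqrt_pow_le_two (n : ℕ) :
    √(n + 1) * ∫ t in (0 : ℝ)..1, √(1 - t ^ 2) ^ n ≤ 2 := by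
  set s : ℝ := √(n + 1)
  have hn : (0 : ℝ) ≤ n := n.cast_nonneg
  have hs2 : s ^ 2 = n + 1 := Real.sq_sqrt (by positivity)
  have hs : 1 ≤ s := Real.one_le_sqrt.2 (by linarith)
  have hs0 : 0 < s := by linarith
  have ha : s⁻¹ ≤ 1 := inv_le_one_of_one_le₀ hs
  have ha0 : 0 < s⁻¹ := by positivity
  have hc : Continuous fun t : ℝ => √(1 - t ^ 2) ^ n := by fun_prop
  have hle1 : ∀ t : ℝ, √(1 - t ^ 2) ≤ 1 := fun t =>
    Real.sqrt_le_one.2 (by nlinarith [sq_nonneg t])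
  have hnear : ∫ t in (0 : ℝ)..s⁻¹, √(1 - t ^ 2) ^ n ≤ s⁻¹ := by
    calc _ ≤ ∫ t in (0 : ℝ)..s⁻¹, (1 : ℝ) :=
          intervalIntegral.integral_mono_on ha0.le (hc.intervalIntegrable _ _)
            (by simp) fun t _ => pow_le_one₀ (by positivity) (hle1 t)
      _ = s⁻¹ := by simp
  have hfar : ∫ t in s⁻¹..1, √(1 - t ^ 2) ^ n ≤ s⁻¹ := by
    calc _ ≤ ∫ t in s⁻¹..1, s * (t * √(1 - t ^ 2) ^ n) := by
          refine intervalIntegral.integral_mono_on ha (hc.intervalIntegrable _ _)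
            (Continuous.intervalIntegrable (by fun_prop) _ _) fun t ht => ?_
          have : 1 ≤ s * t := by
            simpa [hs0.ne'] using mul_le_mul_of_nonneg_left ht.1 hs0.le
          rw [← mul_assoc]
          exact le_mul_of_one_le_left (by positivity) this
      _ = s * (√(1 - s⁻¹ ^ 2) ^ (n + 2) / (n + 2)) := by
          rw [intervalIntegral.integral_const_mul, integral_mul_sqrt_pow n ha0.le ha]
      _ ≤ s * (1 / s ^ 2) := by
          rw [hs2]
          gcongr
          · exact pow_le_one₀ (by positivity) (hle1 _)
          · norm_num
      _ = s⁻¹ := by field_simp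
  rw [← intervalIntegral.integral_add_adjacent_intervals (hc.intervalIntegrable 0 s⁻¹)
    (hc.intervalIntegrable s⁻¹ 1)]
  calc s * _ ≤ s * (s⁻¹ + s⁻¹) := by gcongr
    _ = 2 := by field_simp; norm_num

theorem integral_sqrt_pow_neg_one_one (n : ℕ) :
    ∫ t in (-1 : ℝ)..1, √(1 - t ^ 2) ^ n = 2 * ∫ t in (0 : ℝ)..1, √(1 - t ^ 2) ^ n := by
  have hc : Continuous fun t : ℝ => √(1 - t ^ 2) ^ n := by fun_prop
  rw [← intervalIntegral.integral_add_adjacent_intervals (hc.intervalIntegrable (-1) 0)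
    (hc.intervalIntegrable 0 1)]
  have := intervalIntegral.integral_comp_neg (a := 0) (b := 1) fun t : ℝ => √(1 - t ^ 2) ^ n
  simp only [neg_sq, neg_zero] at this
  rw [← this]
  ring

theorem one_sub_sq_pow_mul_integral_le (n : ℕ) {a : ℝ} (h0 : 0 ≤ a) (h1 : a ≤ 1) :
    1 / 12 * (1 - a ^ 2) ^ (n + 1) * ∫ t in (-1 : ℝ)..1, √(1 - t ^ 2) ^ n ≤
      ∫ t in a..1, √(1 - t ^ 2) ^ n := by
  set g : ℝ → ℝ := fun t => √(1 - t ^ 2) ^ n with hg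
  have hc : Continuous g := by fun_prop
  rw [integral_sqrt_pow_neg_one_one]
  set I : ℝ := ∫ t in (0 : ℝ)..1, √(1 - t ^ 2) ^ n with hI
  have hI0 : 0 ≤ I := intervalIntegral.integral_nonneg zero_le_one fun t _ => by positivity
  have hd : ∀ t, HasDerivAt
      (fun t : ℝ => (∫ u in t..1, g u) - I / 6 * (1 - t ^ 2) ^ (n + 1))
      (-g t - I / 6 * ((n + 1) * (1 - t ^ 2) ^ n * (-(2 * t)))) t := by
    intro t
    refine (intervalIntegral.integral_hasDerivAt_left (hc.intervalIntegrable _ _)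
      hc.stronglyMeasurable.stronglyMeasurableAtFilter hc.continuousAt).sub ?_
    have h := ((((hasDerivAt_id t).pow 2).const_sub 1).pow (n + 1)).const_mul (I / 6)
    refine h.congr_deriv ?_
    simp
  have hanti : AntitoneOn (fun t : ℝ => (∫ u in t..1, g u) - I / 6 * (1 - t ^ 2) ^ (n + 1))
      (Set.Icc 0 1) := by
    refine antitoneOn_of_hasDerivWithinAt_nonpos (convex_Icc 0 1)
      (fun t _ => (hd t).continuousAt.continuousWithinAt)
      (fun t _ => (hd t).hasDerivWithinAt) fun t ht => ?_
    rw [interior_Icc] at ht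
    have ht2 : 0 ≤ 1 - t ^ 2 := by nlinarith [ht.1, ht.2]
    have hg0 : 0 ≤ g t := by positivity
    have hgsq : (1 - t ^ 2) ^ n = g t * g t := by
      rw [hg, ← mul_pow, Real.mul_self_sqrt ht2]
    have hA := sqrt_mul_mul_sqrt_pow_le_one n ht.1.le ht.2.le
    have hB := sqrt_mul_integral_sqrt_pow_le_two n
    have hAB : (n + 1) * (I * (t * g t)) ≤ 2 := by
      calc ((n : ℝ) + 1) * (I * (t * g t))
          = (√(n + 1) * √(n + 1)) * (I * (t * g t)) := by
            rw [Real.mul_self_sqrt (by positivity)]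
        _ = (√(n + 1) * I) * (√(n + 1) * (t * g t)) := by ring
        _ ≤ 2 * 1 := mul_le_mul hB hA (mul_nonneg (by positivity) (mul_nonneg ht.1.le hg0))
            (by norm_num)
        _ = 2 := by norm_num
    rw [hgsq]
    nlinarith
  have h := hanti ⟨h0, h1⟩ ⟨zero_le_one, le_rfl⟩ h1
  simp only [intervalIntegral.integral_same, one_pow, sub_self, zero_pow n.succ_ne_zero,
    mul_zero] at h
  linarith

theorem le_volume_ball_inter_inner_gt {n : ℕ} {v : EuclideanSpace ℝ (Fin (n + 1))} (hv : ‖v‖ = 1)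
    {a : ℝ} (h0 : 0 ≤ a) (h1 : a ≤ 1) :
    ENNReal.ofReal (1 / 12 * (1 - a ^ 2) ^ (n + 1)) *
        volume (ball (0 : EuclideanSpace ℝ (Fin (n + 1))) 1) ≤
      volume {y : EuclideanSpace ℝ (Fin (n + 1)) | ‖y‖ < 1 ∧ a < ⟪v, y⟫} := by
  have hball : ball (0 : EuclideanSpace ℝ (Fin (n + 1))) 1 = {y | ‖y‖ < 1 ∧ -1 < ⟪v, y⟫} := by
    ext y
    simp only [mem_ball_zero_iff, Set.mem_ofPred_eq, iff_self_and]
    intro hy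
    have := abs_le.1 (abs_real_inner_le_norm v y)
    rw [hv] at this
    linarith [this.1]
  have ha2 : 0 ≤ 1 - a ^ 2 := by nlinarith
  rw [hball, volume_ball_inter_inner_gt hv le_rfl (by norm_num),
    volume_ball_inter_inner_gt hv (by linarith) h1, ← mul_assoc,
    ← ENNReal.ofReal_mul (by positivity)]
  gcongr
  exact one_sub_sq_pow_mul_integral_le n h0 h1

theorem deltaAdv_affine {d : ℕ} {w : EuclideanSpace ℝ (Fin d)} (hw : w ≠ 0) {b : ℝ}
    {x : EuclideanSpace ℝ (Fin d)} (hx : 0 < ⟪w, x⟫ + b) :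
    deltaAdv (fun y => ⟪w, y⟫ + b) x = (⟪w, x⟫ + b) / ‖w‖ := by
  have hw0 : 0 < ‖w‖ := norm_pos_iff.2 hw
  refine IsLeast.csInf_eq ⟨⟨-((⟪w, x⟫ + b) / ‖w‖ ^ 2) • w, ?_, ?_⟩, ?_⟩
  · rw [norm_smul, norm_neg, Real.norm_of_nonneg (by positivity)]
    field_simp
  · refine le_of_eq ?_
    simp only [inner_add_right, real_inner_smul_right, real_inner_self_eq_norm_sq]
    field_simp
    ring
  · rintro _ ⟨r, rfl, hr⟩
    have h1 : ⟪w, x + r⟫ + b ≤ 0 := nonpos_of_mul_nonpos_right hr hx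
    rw [inner_add_right] at h1
    rw [div_le_iff₀ hw0]
    have := (abs_le.1 (abs_real_inner_le_norm w r)).1
    linarith [mul_comm ‖w‖ ‖r‖]

theorem exp_sq_div_two_le_two_mul {a : ℝ} (h : 1 / 2 ≤ a ^ 2) (h0 : 0 ≤ a) (h1 : a ≤ 1) :
    Real.exp (a ^ 2 / 2) ≤ 2 * a := by
  have ha2 : a ^ 2 ≤ 1 := by nlinarith
  have hexp : (1 - a ^ 2 / 2) * Real.exp (a ^ 2 / 2) ≤ 1 := by
    calc _ ≤ Real.exp (-(a ^ 2 / 2)) * Real.exp (a ^ 2 / 2) := by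
          gcongr; linarith [Real.add_one_le_exp (-(a ^ 2 / 2))]
      _ = 1 := by rw [← Real.exp_add]; simp
  have hpoly : 1 ≤ a * (2 - a ^ 2) := by
    refine (one_le_sq_iff₀ (mul_nonneg h0 (by linarith))).1 ?_
    nlinarith [mul_nonneg (sub_nonneg.2 ha2)
      (by nlinarith [sq_nonneg a] : 0 ≤ 3 * a ^ 2 - 1 - (a ^ 2) ^ 2)]
  refine le_of_mul_le_mul_right ?_ (by linarith : 0 < 2 - a ^ 2)
  linarith

section Sector

open scoped Pointwise

/-- The spherical sector of the unit ball around `v` with opening `a` fits in a ball of radius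
`exp (-a² / 2)`. -/
theorem exists_closedBall_sector_subset {E : Type*} [NormedAddCommGroup E]
    [InnerProductSpace ℝ E] {v : E} (hv : ‖v‖ = 1) {a : ℝ} (h0 : 0 < a) :
    ∃ c : E, Set.Ioo (0 : ℝ) 1 • {z : E | ‖z‖ = 1 ∧ a ≤ ⟪v, z⟫} ⊆
      closedBall c (Real.exp (-(a ^ 2 / 2))) := by
  have of_quadratic_le : ∀ (s r : ℝ), r ≤ Real.exp (-(a ^ 2 / 2)) → 0 ≤ r →
      (∀ ρ p : ℝ, 0 < ρ → ρ < 1 → a ≤ p → p ≤ 1 → ρ ^ 2 - 2 * s * ρ * p + s ^ 2 ≤ r ^ 2) →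
      ∃ c : E, Set.Ioo (0 : ℝ) 1 • {z : E | ‖z‖ = 1 ∧ a ≤ ⟪v, z⟫} ⊆
        closedBall c (Real.exp (-(a ^ 2 / 2))) := by
    intro s r hr hr0 h
    refine ⟨s • v, ?_⟩
    rintro _ ⟨ρ, hρ, z, ⟨hz, hzv⟩, rfl⟩
    have hp : ⟪v, z⟫ ≤ 1 := by simpa [hv, hz] using real_inner_le_norm v z
    refine closedBall_subset_closedBall hr ?_
    rw [mem_closedBall, dist_eq_norm]
    refine abs_le_of_sq_le_sq' ?_ hr0 |>.2
    have : ‖ρ • z - s • v‖ ^ 2 = ρ ^ 2 - 2 * s * ρ * ⟪v, z⟫ + s ^ 2 := by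
      rw [norm_sub_sq_real, norm_smul, norm_smul, hz, hv, real_inner_smul_left,
        real_inner_smul_right, real_inner_comm]
      simp
      ring
    simpa [this] using h ρ _ hρ.1 hρ.2 hzv hp
  rcases le_total (a ^ 2) (1 / 2) with ha | ha
  · refine of_quadratic_le a √(1 - a ^ 2) ?_ (by positivity) fun ρ p hρ0 hρ1 hp _ => ?_
    · rw [Real.sqrt_le_left (by positivity), ← Real.exp_nat_mul]
      convert Real.add_one_le_exp (-a ^ 2) using 1
      · ring
      · congr 1; push_cast; ring
    · rw [Real.sq_sqrt (by linarith)]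
      nlinarith [mul_le_mul_of_nonneg_left hp (mul_pos h0 hρ0).le,
        mul_nonneg (sub_nonneg.2 hρ1.le) (by linarith : 0 ≤ 1 + ρ - 2 * a ^ 2)]
  · rcases le_or_gt a 1 with h1 | h1
    · refine of_quadratic_le (1 / (2 * a)) (1 / (2 * a)) ?_ (by positivity) fun ρ p hρ0 hρ1 hp _ => ?_
      · rw [Real.exp_neg, one_div]
        exact inv_anti₀ (by positivity) (exp_sq_div_two_le_two_mul ha h0.le h1)
      · have : 1 ≤ p / a := (one_le_div h0).2 hp
        have h2 : 2 * (1 / (2 * a)) * ρ * p = ρ * (p / a) := by field_simp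
        rw [h2]
        nlinarith
    · exact of_quadratic_le 0 0 (by positivity) le_rfl fun ρ p _ _ hp hp1 => by linarith

theorem unifSphere_apply {d : ℕ} (hd : 0 < d) (η : ℝ) {s : Set (EuclideanSpace ℝ (Fin d))}
    (hs : MeasurableSet s) :
    unifSphere d η s =
      volume (Set.Ioo (0 : ℝ) 1 • {z : EuclideanSpace ℝ (Fin d) | ‖z‖ = 1 ∧ η • z ∈ s}) /
        volume (ball (0 : EuclideanSpace ℝ (Fin d)) 1) := by
  have hm : Measurable fun z : sphere (0 : EuclideanSpace ℝ (Fin d)) 1 =>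
      η • (z : EuclideanSpace ℝ (Fin d)) := by fun_prop
  have himage : ((↑) '' ((fun z : sphere (0 : EuclideanSpace ℝ (Fin d)) 1 =>
      η • (z : EuclideanSpace ℝ (Fin d))) ⁻¹' s) : Set (EuclideanSpace ℝ (Fin d))) =
      {z | ‖z‖ = 1 ∧ η • z ∈ s} := by
    ext z
    simp [and_comm]
  rw [unifSphere, Measure.smul_apply, Measure.map_apply hm hs, Measure.toSphere_apply' _ (hm hs),
    Measure.toSphere_apply_univ, himage, smul_eq_mul, mul_comm, ← div_eq_mul_inv,
    ENNReal.mul_div_mul_left]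
  · simpa using hd.ne'
  · exact ENNReal.natCast_ne_top _

theorem unifSphere_halfspace {d : ℕ} (hd : 0 < d) {w : EuclideanSpace ℝ (Fin d)} (hw : w ≠ 0)
    (b : ℝ) (x : EuclideanSpace ℝ (Fin d)) {η : ℝ} (hη : 0 < η) :
    unifSphere d η {n : EuclideanSpace ℝ (Fin d) | ⟪w, x + n⟫ + b ≤ 0} =
      volume (Set.Ioo (0 : ℝ) 1 • {z : EuclideanSpace ℝ (Fin d) |
        ‖z‖ = 1 ∧ (⟪w, x⟫ + b) / ‖w‖ / η ≤ ⟪-(‖w‖⁻¹ • w), z⟫}) /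
        volume (ball (0 : EuclideanSpace ℝ (Fin d)) 1) := by
  have hw0 : 0 < ‖w‖ := norm_pos_iff.2 hw
  have hs : MeasurableSet {n : EuclideanSpace ℝ (Fin d) | ⟪w, x + n⟫ + b ≤ 0} :=
    measurableSet_le (by fun_prop) measurable_const
  rw [unifSphere_apply hd η hs]
  congr 4
  ext z
  simp only [Set.mem_ofPred_eq, inner_neg_left, real_inner_smul_left, inner_add_right,
    real_inner_smul_right]
  rw [div_div, div_le_iff₀ (by positivity)]
  have : -(‖w‖⁻¹ * ⟪w, z⟫) * (‖w‖ * η) = -(η * ⟪w, z⟫) := by field_simp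
  rw [this]
  refine and_congr_right fun _ => ⟨fun h => by linarith, fun h => by linarith⟩

end Sector

/-- **Sphere-noise bounds for linear classifiers (proof of Theorem 2).**
For `f(x) = wᵀx + b` with `w ≠ 0`, `f(x) > 0` and `η > 0`, with `n` uniform on the
sphere of radius `η`:
`P(f(x+n) ≤ 0) ≤ 2 exp(−Δ_adv(x;f)² d / (2η²))`; and if `η ≥ Δ_adv(x;f)` then
`P(f(x+n) ≤ 0) ≥ (1/12)(1 − Δ_adv(x;f)²/η²)^d`. -/
theorem linear_sphere_flip_probability_bounds {d : ℕ} (hd : 0 < d)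
    (w : EuclideanSpace ℝ (Fin d)) (hw : w ≠ 0) (b : ℝ)
    (x : EuclideanSpace ℝ (Fin d)) (hx : 0 < ⟪w, x⟫ + b) (η : ℝ) (hη : 0 < η) :
    unifSphere d η {n : EuclideanSpace ℝ (Fin d) | ⟪w, x + n⟫ + b ≤ 0} ≤
      ENNReal.ofReal (2 * Real.exp
        (-((deltaAdv (fun y => ⟪w, y⟫ + b) x) ^ 2 * d) / (2 * η ^ 2))) ∧
    (deltaAdv (fun y => ⟪w, y⟫ + b) x ≤ η →
      ENNReal.ofReal ((1 / 12) *
          (1 - (deltaAdv (fun y => ⟪w, y⟫ + b) x) ^ 2 / η ^ 2) ^ d) ≤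
        unifSphere d η {n : EuclideanSpace ℝ (Fin d) | ⟪w, x + n⟫ + b ≤ 0}) := by
  have hw0 : 0 < ‖w‖ := norm_pos_iff.2 hw
  have hv : ‖-(‖w‖⁻¹ • w)‖ = 1 := by
    rw [norm_neg, norm_smul, norm_inv, norm_norm, inv_mul_cancel₀ hw0.ne']
  have hB0 : volume (ball (0 : EuclideanSpace ℝ (Fin d)) 1) ≠ 0 :=
    (measure_ball_pos _ _ one_pos).ne'
  have hB1 : volume (ball (0 : EuclideanSpace ℝ (Fin d)) 1) ≠ ∞ := measure_ball_lt_top.ne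
  rw [unifSphere_halfspace hd hw b x hη, deltaAdv_affine hw hx]
  have hΔ : 0 < (⟪w, x⟫ + b) / ‖w‖ := by positivity
  generalize (⟪w, x⟫ + b) / ‖w‖ = Δ at hΔ
  generalize -(‖w‖⁻¹ • w) = v at hv
  have ha : 0 < Δ / η := by positivity
  rw [← div_pow]
  constructor
  · obtain ⟨c, hc⟩ := exists_closedBall_sector_subset hv ha
    rw [ENNReal.div_le_iff hB0 hB1]
    refine (measure_mono hc).trans ?_
    rw [Measure.addHaar_closedBall _ _ (Real.exp_pos _).le, finrank_euclideanSpace_fin,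
      ← Real.exp_nat_mul]
    gcongr
    have : (d : ℝ) * -((Δ / η) ^ 2 / 2) = -(Δ ^ 2 * d) / (2 * η ^ 2) := by
      rw [div_pow]; field_simp
    rw [this]
    linarith [Real.exp_pos (-(Δ ^ 2 * d) / (2 * η ^ 2))]
  · intro hle
    obtain ⟨n, rfl⟩ := Nat.exists_eq_succ_of_ne_zero hd.ne'
    rw [ENNReal.le_div_iff_mul_le (.inl hB0) (.inl hB1)]
    refine (le_volume_ball_inter_inner_gt hv ha.le ((div_le_one hη).2 hle)).trans
      (measure_mono ?_)
    rintro y ⟨hy1, hy⟩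
    have hy0 : 0 < ‖y‖ := norm_pos_iff.2 fun h => by
      rw [h, inner_zero_right] at hy; linarith
    refine ⟨‖y‖, ⟨hy0, hy1⟩, ‖y‖⁻¹ • y, ⟨?_, ?_⟩, ?_⟩
    · rw [norm_smul, norm_inv, norm_norm, inv_mul_cancel₀ hy0.ne']
    · rw [real_inner_smul_right]
      exact hy.le.trans (le_mul_of_one_le_left (ha.trans hy).le (one_le_inv_iff₀.2 ⟨hy0, hy1.le⟩))
    · simp [smul_smul, hy0.ne']
end
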